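/- A loop in the cylinder which is homologically non-trivial meets every path joining the two boundary circles: let k ∈ ℤ with k ≠ 0, let γ : ℝ → ℝ × ℝ be continuous with (γ t).1 ∈ [0, 1] for all t and γ (t + 1) = γ t + (0, k) for all t ∈ ℝ, and let c : ℝ → ℝ × ℝ be continuous with (c s).1 ∈ [0, 1] for all s ∈ [0, 1], (c 0).1 = 0 and (c 1).1 = 1. Then there exist t ∈ ℝ, s ∈ [0, 1] and n ∈ ℤ with γ t = c s + (0, n). -/

import Mathlib

open Real in
theorem aux_cos (f : ℝ → ℝ) (hf : Continuous f) (h : ∀ x, 0 ≤ cos (f x)) :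
    ∃ n : ℤ, ∀ x, |f x - n * (2 * π)| ≤ π / 2 := by
  have hpi := Real.pi_pos
  refine ⟨round (f 0 / (2 * π)), ?_⟩
  set n := round (f 0 / (2 * π)) with hn
  have hg : Continuous fun x => f x - n * (2 * π) := by fun_prop
  have hc : ∀ x, 0 ≤ cos (f x - n * (2 * π)) := fun x => by
    rw [Real.cos_sub_int_mul_two_pi]; exact h x
  have h0 : |f 0 - n * (2 * π)| ≤ π := by
    have h1 := abs_sub_round (f 0 / (2 * π))
    rw [← hn] at h1
    have h2 : f 0 - n * (2 * π) = (f 0 / (2 * π) - n) * (2 * π) := by field_simp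
    rw [h2, abs_mul, abs_of_pos (by positivity : 0 < 2 * π)]
    nlinarith
  have key : ∀ g : ℝ → ℝ, Continuous g → (∀ x, 0 ≤ cos (g x)) → |g 0| ≤ π → ∀ x, g x ≤ π / 2 := by
    intro g hg hc h0 x
    rw [abs_le] at h0
    have h00 : g 0 ≤ π / 2 := by
      by_contra! hlt
      have := Real.cos_neg_of_pi_div_two_lt_of_lt hlt (by linarith)
      linarith [hc 0]
    by_contra! hlt
    obtain ⟨y, hy⟩ := mem_range_of_exists_le_of_exists_ge (c := min (g x) π) hg
      ⟨0, le_min (by linarith) (by linarith)⟩ ⟨x, min_le_left _ _⟩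
    have h1 : π / 2 < g y := by rw [hy]; exact lt_min hlt (by linarith)
    have h2 : g y ≤ π := by rw [hy]; exact min_le_right _ _
    have := Real.cos_neg_of_pi_div_two_lt_of_lt h1 (by linarith)
    linarith [hc y]
  intro x
  have k1 := key (fun x => f x - n * (2 * π)) (by fun_prop) hc h0 x
  have k2 := key (fun x => -(f x - n * (2 * π))) (by fun_prop)
    (fun x => by rw [Real.cos_neg]; exact hc x) (by simpa only [abs_neg] using h0) x
  rw [abs_le]
  constructor <;> linarith

theorem aux_int {p : ℝ} (hp : 0 < p) (x u v : ℝ) (hu : |x - u * p| ≤ p / 2)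
    (hv : |x - v * p| ≤ p / 2) : |u - v| ≤ 1 := by
  rw [abs_le] at *
  constructor <;> nlinarith

open Real in
theorem aux_pm (F : ℝ × ℝ → ℂ) (hF : Continuous F) (hF0 : ∀ p, F p ≠ 0) (a b : ℝ)
    (h0 : ∀ t, 0 ≤ (F (t, 0)).re) (h1 : ∀ t, (F (t, 1)).re ≤ 0)
    (ha : ∀ s, (F (a, s)).im ≤ 0) (hb : ∀ s, 0 ≤ (F (b, s)).im) : False := by
  have hpi := Real.pi_pos
  obtain ⟨L, ⟨-, hL⟩, -⟩ := Complex.isCoveringMapOn_exp.existsUnique_continuousMap_lifts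
    (⟨F, hF⟩ : C(ℝ × ℝ, ℂ)) (a₀ := (0, 0)) (e₀ := Complex.log (F (0, 0)))
    (by simpa using Complex.exp_log (hF0 _)) (fun p => by simpa using hF0 p)
  have hL' : ∀ p, Complex.exp (L p) = F p := fun p => congrFun hL p
  have hre : ∀ p, (F p).re = Real.exp (L p).re * cos (L p).im := fun p => by
    rw [← hL', Complex.exp_re]
  have him : ∀ p, (F p).im = Real.exp (L p).re * sin (L p).im := fun p => by
    rw [← hL', Complex.exp_im]
  have hcont : Continuous fun p => (L p).im := Complex.continuous_im.comp L.continuous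
  obtain ⟨A, hA⟩ := aux_cos (fun t => (L (t, 0)).im) (hcont.comp (by fun_prop)) (fun t => by
    have := h0 t
    rw [hre] at this
    exact nonneg_of_mul_nonneg_right this (Real.exp_pos _))
  obtain ⟨C, hC⟩ := aux_cos (fun t => (L (t, 1)).im - π)
    ((hcont.comp (by fun_prop : Continuous fun t : ℝ => (t, (1:ℝ)))).sub continuous_const)
    (fun t => by
    have := h1 t
    rw [hre] at this
    rw [Real.cos_sub_pi]
    have := Real.exp_pos (L (t, 1)).re
    by_contra! hh
    nlinarith)
  obtain ⟨B, hB⟩ := aux_cos (fun s => (L (b, s)).im - π / 2)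
    ((hcont.comp (by fun_prop : Continuous fun t : ℝ => (b, t))).sub continuous_const)
    (fun t => by
    have := hb t
    rw [him] at this
    rw [Real.cos_sub_pi_div_two]
    exact nonneg_of_mul_nonneg_right this (Real.exp_pos _))
  obtain ⟨D, hD⟩ := aux_cos (fun s => (L (a, s)).im + π / 2)
    ((hcont.comp (by fun_prop : Continuous fun t : ℝ => (a, t))).add continuous_const)
    (fun t => by
    have := ha t
    rw [him] at this
    rw [Real.cos_add_pi_div_two]
    have := Real.exp_pos (L (a, t)).re
    by_contra! hh
    nlinarith)
  have e1 := aux_int hpi (L (b, 0)).im (2 * A) (2 * B + 1 / 2)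
    (by convert hA b using 2; ring) (by convert hB 0 using 2; ring)
  have e2 := aux_int hpi (L (b, 1)).im (2 * C + 1) (2 * B + 1 / 2)
    (by convert hC b using 2; ring) (by convert hB 1 using 2; ring)
  have e3 := aux_int hpi (L (a, 1)).im (2 * C + 1) (2 * D - 1 / 2)
    (by convert hC a using 2; ring) (by convert hD 1 using 2; ring)
  have e4 := aux_int hpi (L (a, 0)).im (2 * A) (2 * D - 1 / 2)
    (by convert hA a using 2; ring) (by convert hD 0 using 2; ring)
  rw [abs_le] at e1 e2 e3 e4
  have i1 : A < B + 1 := by have : (A : ℝ) < B + 1 := by linarith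
                            exact_mod_cast this
  have i2 : B < A + 1 := by have : (B : ℝ) < A + 1 := by linarith
                            exact_mod_cast this
  have i3 : C < B + 1 := by have : (C : ℝ) < B + 1 := by linarith
                            exact_mod_cast this
  have i4 : B < C + 1 := by have : (B : ℝ) < C + 1 := by linarith
                            exact_mod_cast this
  have i5 : C < D := by have : (C : ℝ) < D := by linarith
                        exact_mod_cast this
  have i6 : D < A + 1 := by have : (D : ℝ) < A + 1 := by linarith
                            exact_mod_cast this
  omega

/-- A homologically non-trivial loop in the cylinder `[0,1] × ℝ/ℤ` meets every path joining
the two boundary circles. -/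
theorem cylinder_essential_loop_meets_path
    (k : ℤ) (hk : k ≠ 0)
    (γ : ℝ → ℝ × ℝ) (hγ : Continuous γ)
    (hγ1 : ∀ t : ℝ, (γ t).1 ∈ Set.Icc (0 : ℝ) 1)
    (hγ2 : ∀ t : ℝ, γ (t + 1) = γ t + (0, (k : ℝ)))
    (c : ℝ → ℝ × ℝ) (hc : Continuous c)
    (hc1 : ∀ s ∈ Set.Icc (0 : ℝ) 1, (c s).1 ∈ Set.Icc (0 : ℝ) 1)
    (hc0 : (c 0).1 = 0) (hc2 : (c 1).1 = 1) :
    ∃ t : ℝ, ∃ s ∈ Set.Icc (0 : ℝ) 1, ∃ n : ℤ, γ t = c s + (0, (n : ℝ)) := by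
  by_contra! hcon
  have hcl : ∀ s : ℝ, max 0 (min s 1) ∈ Set.Icc (0 : ℝ) 1 := fun s =>
    ⟨le_max_left _ _, max_le zero_le_one (min_le_right _ _)⟩
  have hup : ∀ n : ℕ, ∀ t : ℝ, (γ (t + n)).2 = (γ t).2 + n * k := by
    intro n t
    induction n with
    | zero => simp
    | succ n ih =>
      have := congrArg Prod.snd (hγ2 (t + n))
      rw [Prod.snd_add, ih] at this
      push_cast
      rw [← add_assoc, this]
      ring
  have hz : ∀ n : ℤ, (γ n).2 = (γ 0).2 + n * k := by
    intro n
    obtain ⟨m, rfl | rfl⟩ := n.eq_nat_or_neg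
    · simpa using hup m 0
    · have := hup m (-m)
      rw [neg_add_cancel] at this
      push_cast
      linarith
  obtain ⟨M, hM⟩ := (isCompact_Icc (a := (0:ℝ)) (b := 1)).exists_bound_of_continuousOn
    (f := fun s => (c s).2) (by fun_prop)
  obtain ⟨N, hN⟩ := exists_nat_gt (M + |(γ 0).2|)
  have hk2 : (1 : ℝ) ≤ k * k := by
    have : 1 ≤ k * k := by have := mul_self_pos.mpr hk; omega
    exact_mod_cast this
  have hNk : (N : ℝ) ≤ N * (k * k) := le_mul_of_one_le_right (Nat.cast_nonneg _) hk2
  have habs := abs_le.mp (le_refl |(γ 0).2|)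
  refine aux_pm (fun p => ⟨(γ p.1).1 - (c (max 0 (min p.2 1))).1,
    (γ p.1).2 - (c (max 0 (min p.2 1))).2⟩) ?_ ?_ ((-(N * k) : ℤ) : ℝ) ((N * k : ℤ) : ℝ) ?_ ?_ ?_ ?_
  · have : Continuous fun p : ℝ × ℝ => Complex.equivRealProdCLM.symm
      (γ p.1 - c (max 0 (min p.2 1))) := by fun_prop
    convert this using 2
    apply Complex.ext <;> simp
  · intro p hp
    refine hcon p.1 _ (hcl p.2) 0 ?_
    have h1 := congrArg Complex.re hp
    have h2 := congrArg Complex.im hp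
    simp only [Complex.zero_re, Complex.zero_im] at h1 h2
    ext
    · simp; linarith
    · simp; linarith
  · intro t
    simpa [hc0] using (hγ1 t).1
  · intro t
    simpa [hc2] using (hγ1 t).2
  · intro s
    have h1 := abs_le.mp (hM _ (hcl s))
    simp only [hz]
    push_cast
    nlinarith
  · intro s
    have h1 := abs_le.mp (hM _ (hcl s))
    simp only [hz]
    push_cast
    nlinarith
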